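/- Let {X_n, n ≥ 1} be a strictly stationary sequence of associated random variables with |X_n| ≤ C_1 < ∞ for all n, such that X_1 has a bounded density. If Σ_{j=1}^∞ Cov(X_1, X_j)^γ < ∞ for some 0 < γ < 1/6, then Σ_{1 ≤ i < j ≤ n} Σ_{1 ≤ k < l ≤ n} |E( h^(2)(X_i, X_j) h^(2)(X_k, X_l) )| = o(n³) as n → ∞, where h^(2) is the degenerate part of the Gini kernel. -/

import Mathlib

open MeasureTheory ProbabilityTheory Filter Topology

noncomputable section

variable {Ω : Type*} [MeasurableSpace Ω]

/-- Covariance of two real-valued random variables. -/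
def cov (μ : Measure Ω) (f g : Ω → ℝ) : ℝ :=
  ∫ ω, f ω * g ω ∂μ - (∫ ω, f ω ∂μ) * (∫ ω, g ω ∂μ)

/-- A family of real-valued random variables is *associated* if every two coordinatewise
nondecreasing functions of any finite subcollection have nonnegative covariance
(whenever the relevant integrals exist). -/
def IsAssociated (μ : Measure Ω) {ι : Type*} (X : ι → Ω → ℝ) : Prop :=
  ∀ (S : Finset ι) (h g : (S → ℝ) → ℝ), Monotone h → Monotone g →
    Measurable h → Measurable g →
    Integrable (fun ω => h fun i => X i ω) μ →
    Integrable (fun ω => g fun i => X i ω) μ →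
    Integrable (fun ω => h (fun i => X i ω) * g (fun i => X i ω)) μ →
    0 ≤ cov μ (fun ω => h fun i => X i ω) (fun ω => g fun i => X i ω)

/-- Strict stationarity of the sequence `X 1, X 2, ...`. -/
def StrictStationary (μ : Measure Ω) (X : ℕ → Ω → ℝ) : Prop :=
  ∀ k n : ℕ, Measure.map (fun ω => fun i : Fin n => X (1 + (i : ℕ) + k) ω) μ =
    Measure.map (fun ω => fun i : Fin n => X (1 + (i : ℕ)) ω) μ

/-- Convergence in distribution to the standard normal law `N(0,1)`. -/
def TendstoStdGaussian (μ : Measure Ω) (Z : ℕ → Ω → ℝ) : Prop :=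
  ∀ f : BoundedContinuousFunction ℝ ℝ,
    Tendsto (fun n => ∫ ω, f (Z n ω) ∂μ) atTop
      (𝓝 (∫ x, f x ∂(gaussianReal 0 1)))

/-- `ρ₁(x) = ∫ |x − y| dF(y)` where `F` is the law of `X₁`. -/
def rho1 (μ : Measure Ω) (X1 : Ω → ℝ) (x : ℝ) : ℝ := ∫ y, |x - y| ∂(μ.map X1)

/-- Gini mean difference parameter `θ = ∫∫ |x − y| dF(x) dF(y)`. -/
def giniTheta (μ : Measure Ω) (X1 : Ω → ℝ) : ℝ := ∫ x, rho1 μ X1 x ∂(μ.map X1)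

/-- Degenerate part of the Gini kernel: `h⁽²⁾(x,y) = |x−y| − ρ₁(x) − ρ₁(y) + θ`. -/
def h2 (μ : Measure Ω) (X1 : Ω → ℝ) (x y : ℝ) : ℝ :=
  |x - y| - rho1 μ X1 x - rho1 μ X1 y + giniTheta μ X1

/-- `X` has a bounded probability density (w.r.t. Lebesgue measure). -/
def HasBddDensity (μ : Measure Ω) (X : Ω → ℝ) : Prop :=
  ∃ d : ℝ → ℝ, Measurable d ∧ (∃ M : ℝ, ∀ x, d x ≤ M) ∧ (∀ x, 0 ≤ d x) ∧
    μ.map X = volume.withDensity (fun x => ENNReal.ofReal (d x))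

section Association

variable {μ : Measure Ω} [IsProbabilityMeasure μ] {X : ℕ → Ω → ℝ} {C : ℝ}

lemma memLp_of_forall_abs_le {f : Ω → ℝ} (hf : Measurable f) {B : ℝ} (hB : ∀ ω, |f ω| ≤ B)
    (p : ENNReal) : MemLp f p μ :=
  MemLp.of_bound hf.aestronglyMeasurable B (Eventually.of_forall hB)

lemma integrable_of_forall_abs_le {f : Ω → ℝ} (hf : Measurable f) {B : ℝ}
    (hB : ∀ ω, |f ω| ≤ B) : Integrable f μ :=
  memLp_one_iff_integrable.1 (memLp_of_forall_abs_le hf hB 1)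

lemma cov_eq_covariance {f g : Ω → ℝ} (hf : MemLp f 2 μ) (hg : MemLp g 2 μ) :
    cov μ f g = covariance f g μ :=
  (covariance_eq_sub hf hg).symm

/-- For uniformly bounded associated variables, monotonicity is only needed on the range box. -/
lemma IsAssociated.cov_nonneg_of_monotoneOn (hassoc : IsAssociated μ X)
    (hmeas : ∀ j, Measurable (X j)) (hC : 0 ≤ C) (S : Finset ℕ)
    (hbdd : ∀ n ∈ S, ∀ ω, |X n ω| ≤ C) {h g : (S → ℝ) → ℝ}
    (hh : MonotoneOn h (Set.Icc (fun _ => -C) (fun _ => C)))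
    (hg : MonotoneOn g (Set.Icc (fun _ => -C) (fun _ => C)))
    (hhm : Measurable h) (hgm : Measurable g) :
    0 ≤ cov μ (fun ω => h fun i => X i ω) (fun ω => g fun i => X i ω) := by
  set cl : (S → ℝ) → (S → ℝ) := fun x i => max (-C) (min (x i) C) with hcl
  have hclm : Measurable cl := by fun_prop
  have hclmono : Monotone cl := fun x y hxy i => by
    simp only [hcl]
    exact max_le_max le_rfl (min_le_min (hxy i) le_rfl)
  have hclmem : ∀ x, cl x ∈ Set.Icc (fun _ : S => -C) (fun _ => C) := fun x =>
    ⟨fun i => le_max_left _ _, fun i => max_le (by linarith) (min_le_right _ _)⟩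
  have hbot : (fun _ : S => -C) ∈ Set.Icc (fun _ : S => -C) (fun _ => C) :=
    ⟨le_rfl, fun i => by simp only; linarith⟩
  have htop : (fun _ : S => C) ∈ Set.Icc (fun _ : S => -C) (fun _ => C) :=
    ⟨fun i => by simp only; linarith, le_rfl⟩
  have hclX : ∀ ω, cl (fun i => X i ω) = fun i : S => X i ω := fun ω => by
    funext i
    have := abs_le.1 (hbdd i i.2 ω)
    simp only [hcl]
    rw [min_eq_left this.2, max_eq_right this.1]
  have hXm : Measurable fun ω => fun i : S => X i ω := measurable_pi_lambda _ fun i => hmeas i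
  have bound : ∀ {k : (S → ℝ) → ℝ}, MonotoneOn k (Set.Icc (fun _ => -C) (fun _ => C)) →
      ∀ x, |k (cl x)| ≤ max |k fun _ => -C| |k fun _ => C| := fun hk x => by
    have h1 := hk hbot (hclmem x) (hclmem x).1
    have h2 := hk (hclmem x) htop (hclmem x).2
    exact abs_le_max_abs_abs h1 h2
  have key := hassoc S (h ∘ cl) (g ∘ cl)
    (fun x y hxy => hh (hclmem x) (hclmem y) (hclmono hxy))
    (fun x y hxy => hg (hclmem x) (hclmem y) (hclmono hxy))
    (hhm.comp hclm) (hgm.comp hclm)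
    (integrable_of_forall_abs_le ((hhm.comp hclm).comp hXm) fun ω => bound hh _)
    (integrable_of_forall_abs_le ((hgm.comp hclm).comp hXm) fun ω => bound hg _)
    (integrable_of_forall_abs_le (((hhm.comp hclm).comp hXm).mul ((hgm.comp hclm).comp hXm))
      (B := (max |h fun _ => -C| |h fun _ => C|) * (max |g fun _ => -C| |g fun _ => C|))
      fun ω => by
        rw [abs_mul]
        exact mul_le_mul (bound hh _) (bound hg _) (abs_nonneg _)
          (le_max_of_le_left (abs_nonneg _)))
  simpa only [Function.comp_apply, hclX] using key

lemma IsAssociated.cov_nonneg (hassoc : IsAssociated μ X)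
    (hmeas : ∀ j, Measurable (X j)) (hbdd : ∀ n, 1 ≤ n → ∀ ω, |X n ω| ≤ C) (hC : 0 ≤ C)
    {i j : ℕ} (hi : 1 ≤ i) (hj : 1 ≤ j) : 0 ≤ cov μ (X i) (X j) := by
  refine hassoc.cov_nonneg_of_monotoneOn hmeas hC {i, j} ?_
    (h := fun x => x ⟨i, by simp⟩) (g := fun x => x ⟨j, by simp⟩) ?_ ?_
    (measurable_pi_apply _) (measurable_pi_apply _)
  · simp only [Finset.mem_insert, Finset.mem_singleton]
    rintro n (rfl | rfl) <;> exact hbdd _ ‹_›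
  · exact fun x _ y _ hxy => hxy _
  · exact fun x _ y _ hxy => hxy _

/-- Newman's covariance inequality for Lipschitz functions of bounded associated variables. -/
lemma IsAssociated.abs_cov_le (hassoc : IsAssociated μ X)
    (hmeas : ∀ j, Measurable (X j)) (hbdd : ∀ n, 1 ≤ n → ∀ ω, |X n ω| ≤ C) (hC : 0 ≤ C)
    {i j k l : ℕ} (hi : 1 ≤ i) (hj : 1 ≤ j) (hk : 1 ≤ k) (hl : 1 ≤ l)
    {f : ℝ → ℝ} {G : ℝ → ℝ → ℝ → ℝ} {L a b c : ℝ} (ha : 0 ≤ a) (hb : 0 ≤ b)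
    (hc : 0 ≤ c) (hfm : Measurable f) (hGm : Measurable fun p : ℝ × ℝ × ℝ => G p.1 p.2.1 p.2.2)
    (hf : Monotone f) (hfL : Monotone fun x => L * x - f x)
    (hG : ∀ x y z x' y' z', |x| ≤ C → |y| ≤ C → |z| ≤ C → |x'| ≤ C → |y'| ≤ C → |z'| ≤ C →
      |G x' y' z' - G x y z| ≤ a * |x' - x| + b * |y' - y| + c * |z' - z|) :
    |cov μ (fun ω => f (X i ω)) (fun ω => G (X j ω) (X k ω) (X l ω))| ≤
      L * (a * cov μ (X i) (X j) + b * cov μ (X i) (X k) + c * cov μ (X i) (X l)) := by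
  set S : Finset ℕ := {i, j, k, l} with hS
  have hiS : i ∈ S := by simp [hS]
  have hjS : j ∈ S := by simp [hS]
  have hkS : k ∈ S := by simp [hS]
  have hlS : l ∈ S := by simp [hS]
  have hbS : ∀ n ∈ S, ∀ ω, |X n ω| ≤ C := by
    simp only [hS, Finset.mem_insert, Finset.mem_singleton]
    rintro n (rfl | rfl | rfl | rfl) <;> exact hbdd _ ‹_›
  let U : (S → ℝ) → ℝ := fun x => a * x ⟨j, hjS⟩ + b * x ⟨k, hkS⟩ + c * x ⟨l, hlS⟩
  let V : (S → ℝ) → ℝ := fun x => G (x ⟨j, hjS⟩) (x ⟨k, hkS⟩) (x ⟨l, hlS⟩)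
  let F : (S → ℝ) → ℝ := fun x => f (x ⟨i, hiS⟩)
  have hUm : Measurable U := by fun_prop
  have hFm : Measurable F := by fun_prop
  have htriple : Measurable fun x : S → ℝ => (x ⟨j, hjS⟩, x ⟨k, hkS⟩, x ⟨l, hlS⟩) := by fun_prop
  have hVm : Measurable V := hGm.comp htriple
  have hUmono : Monotone U := fun x y hxy => by
    have h1 := mul_le_mul_of_nonneg_left (hxy ⟨j, hjS⟩) ha
    have h2 := mul_le_mul_of_nonneg_left (hxy ⟨k, hkS⟩) hb
    have h3 := mul_le_mul_of_nonneg_left (hxy ⟨l, hlS⟩) hc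
    simp only [U]; linarith
  have hVlip : ∀ x ∈ Set.Icc (fun _ : S => -C) (fun _ => C),
      ∀ y ∈ Set.Icc (fun _ : S => -C) (fun _ => C), x ≤ y → |V y - V x| ≤ U y - U x := by
    intro x hx y hy hxy
    have hx' : ∀ s, |x s| ≤ C := fun s => abs_le.2 ⟨hx.1 s, hx.2 s⟩
    have hy' : ∀ s, |y s| ≤ C := fun s => abs_le.2 ⟨hy.1 s, hy.2 s⟩
    have hd : ∀ s, |y s - x s| = y s - x s := fun s => abs_of_nonneg (sub_nonneg.2 (hxy s))
    have := hG _ _ _ _ _ _ (hx' ⟨j, hjS⟩) (hx' ⟨k, hkS⟩) (hx' ⟨l, hlS⟩) (hy' ⟨j, hjS⟩)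
      (hy' ⟨k, hkS⟩) (hy' ⟨l, hlS⟩)
    rw [hd, hd, hd] at this
    simp only [U, V]; linarith
  have hFmono : Monotone F := fun x y hxy => hf (hxy _)
  have hLFmono : Monotone fun x : S → ℝ => L * x ⟨i, hiS⟩ - F x :=
    fun x y hxy => hfL (hxy _)
  have hplus := hassoc.cov_nonneg_of_monotoneOn hmeas hC S hbS (h := F)
    (g := fun x => U x + V x) (hFmono.monotoneOn _)
    (fun x hx y hy hxy => by have := (abs_le.1 (hVlip x hx y hy hxy)).1; simp only; linarith)
    hFm (hUm.add hVm)
  have hminus := hassoc.cov_nonneg_of_monotoneOn hmeas hC S hbS (h := F)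
    (g := fun x => U x - V x) (hFmono.monotoneOn _)
    (fun x hx y hy hxy => by have := (abs_le.1 (hVlip x hx y hy hxy)).2; simp only; linarith)
    hFm (hUm.sub hVm)
  have hlin := hassoc.cov_nonneg_of_monotoneOn hmeas hC S hbS
    (h := fun x => L * x ⟨i, hiS⟩ - F x) (g := U)
    (hLFmono.monotoneOn _) (hUmono.monotoneOn _)
    (by fun_prop) hUm
  have hXp : ∀ n, 1 ≤ n → MemLp (X n) 2 μ := fun n hn =>
    memLp_of_forall_abs_le (hmeas n) (hbdd n hn) 2
  have hXm : Measurable fun ω => fun s : S => X s ω := measurable_pi_lambda _ fun s => hmeas s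
  have hFp : MemLp (fun ω => F fun s => X s ω) 2 μ := by
    refine memLp_of_forall_abs_le (hFm.comp hXm) (B := max |f (-C)| |f C|) (fun ω => ?_) 2
    have := abs_le.1 (hbdd i hi ω)
    exact abs_le_max_abs_abs (hf this.1) (hf this.2)
  have hVp : MemLp (fun ω => V fun s => X s ω) 2 μ := by
    refine memLp_of_forall_abs_le (hVm.comp hXm)
      (B := |G 0 0 0| + (a * C + b * C + c * C)) (fun ω => ?_) 2
    have h0 : |(0 : ℝ)| ≤ C := by simpa using hC
    have h1 := hG 0 0 0 _ _ _ h0 h0 h0 (hbdd j hj ω) (hbdd k hk ω) (hbdd l hl ω)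
    simp only [sub_zero] at h1
    have h2 := mul_le_mul_of_nonneg_left (hbdd j hj ω) ha
    have h3 := mul_le_mul_of_nonneg_left (hbdd k hk ω) hb
    have h4 := mul_le_mul_of_nonneg_left (hbdd l hl ω) hc
    have h5 := abs_sub_abs_le_abs_sub (G (X j ω) (X k ω) (X l ω)) (G 0 0 0)
    simp only [Function.comp_apply, V]
    linarith
  have hUp : MemLp (fun ω => U fun s => X s ω) 2 μ :=
    (((hXp j hj).const_mul a).add ((hXp k hk).const_mul b)).add ((hXp l hl).const_mul c)
  have hLp : MemLp (fun ω => L * X i ω) 2 μ := (hXp i hi).const_mul L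
  replace hplus := (hplus.trans_eq (cov_eq_covariance hFp (hUp.add hVp))).trans_eq
    (covariance_add_right hFp hUp hVp)
  replace hminus := (hminus.trans_eq (cov_eq_covariance hFp (hUp.sub hVp))).trans_eq
    (covariance_sub_right hFp hUp hVp)
  replace hlin := (hlin.trans_eq (cov_eq_covariance (hLp.sub hFp) hUp)).trans_eq
    (covariance_sub_left hLp hFp hUp)
  have hlinear : covariance (fun ω => L * X i ω) (fun ω => U fun s => X s ω) μ =
      L * (a * cov μ (X i) (X j) + b * cov μ (X i) (X k) + c * cov μ (X i) (X l)) := by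
    rw [cov_eq_covariance (hXp i hi) (hXp j hj), cov_eq_covariance (hXp i hi) (hXp k hk),
      cov_eq_covariance (hXp i hi) (hXp l hl), covariance_const_mul_left]
    congr 1
    have := covariance_add_right (hXp i hi)
      (((hXp j hj).const_mul a).add ((hXp k hk).const_mul b)) ((hXp l hl).const_mul c)
    have h' := covariance_add_right (hXp i hi) ((hXp j hj).const_mul a) ((hXp k hk).const_mul b)
    rw [covariance_const_mul_right, covariance_const_mul_right] at h'
    rw [h', covariance_const_mul_right] at this
    exact this
  change |cov μ (fun ω => F fun s => X s ω) (fun ω => V fun s => X s ω)| ≤ _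
  rw [cov_eq_covariance hFp hVp, ← hlinear]
  exact abs_le.2 ⟨by linarith, by linarith⟩

end Association

section Ramp

/-- The ramp rising from `0` to `1` on the unit interval `[m, m + 1]`. -/
def ramp (m : ℕ) (u : ℝ) : ℝ := max 0 (min (u - m) 1)

lemma ramp_nonneg (m : ℕ) (u : ℝ) : 0 ≤ ramp m u := le_max_left _ _

lemma ramp_le_one (m : ℕ) (u : ℝ) : ramp m u ≤ 1 := max_le zero_le_one (min_le_right _ _)

lemma ramp_mono (m : ℕ) : Monotone (ramp m) := fun u v huv => by
  unfold ramp; gcongr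

lemma ramp_of_le {m : ℕ} {u : ℝ} (h : u ≤ m) : ramp m u = 0 :=
  max_eq_left ((min_le_left _ _).trans (by linarith))

lemma ramp_of_ge {m : ℕ} {u : ℝ} (h : (m : ℝ) + 1 ≤ u) : ramp m u = 1 := by
  rw [ramp, min_eq_right (by linarith), max_eq_right zero_le_one]

lemma ramp_of_mem {m : ℕ} {u : ℝ} (h : (m : ℝ) ≤ u) (h' : u ≤ m + 1) : ramp m u = u - m := by
  rw [ramp, min_eq_left (by linarith), max_eq_right (by linarith)]

lemma monotone_sub_ramp (m : ℕ) : Monotone fun u => u - ramp m u := fun u v huv => by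
  simp only [ramp]
  rcases le_total (u - m) 1 with h1 | h1 <;> rcases le_total (v - m) 1 with h2 | h2 <;>
    simp only [h1, h2, min_eq_left, min_eq_right, max_def] <;> split_ifs <;> linarith

lemma measurable_ramp (m : ℕ) : Measurable (ramp m) := (ramp_mono m).measurable

lemma abs_ramp_sub_le (m : ℕ) (u v : ℝ) : |ramp m u - ramp m v| ≤ |u - v| := by
  wlog h : v ≤ u
  · rw [abs_sub_comm, abs_sub_comm u]; exact this m v u (le_of_not_ge h)
  have h1 := ramp_mono m h
  have h2 : v - ramp m v ≤ u - ramp m u := monotone_sub_ramp m h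
  rw [abs_of_nonneg (by linarith), abs_of_nonneg (by linarith)]
  linarith

lemma sum_ramp {u : ℝ} (hu : 0 ≤ u) (N : ℕ) : ∑ m ∈ Finset.range N, ramp m u = min u N := by
  induction N with
  | zero => simp [hu]
  | succ N ih =>
    rw [Finset.sum_range_succ, ih, Nat.cast_succ]
    rcases le_total u N with h | h
    · rw [ramp_of_le h, min_eq_left h, min_eq_left (by linarith), add_zero]
    · rcases le_total u (N + 1) with h' | h'
      · rw [ramp_of_mem h h', min_eq_right h, min_eq_left h']; ring
      · rw [ramp_of_ge h', min_eq_right h, min_eq_right h']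

lemma sum_ramp_mul_one_sub_le (u : ℝ) (N : ℕ) :
    ∑ m ∈ Finset.range N, ramp m u * (1 - ramp m u) ≤ min 1 (max 0 (N - u)) := by
  induction N with
  | zero => simp
  | succ N ih =>
    rw [Finset.sum_range_succ, Nat.cast_succ]
    have h0 := le_min_iff.1 ih
    rcases le_total u N with h | h
    · rw [ramp_of_le h, zero_mul, add_zero]
      refine ih.trans (min_le_min le_rfl (max_le_max le_rfl (by linarith)))
    · have h1 : ∑ m ∈ Finset.range N, ramp m u * (1 - ramp m u) ≤ 0 := by
        simpa [max_eq_left (sub_nonpos.2 h)] using h0.2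
      rcases le_total u (N + 1) with h' | h'
      · rw [ramp_of_mem h h', max_eq_right (by linarith), min_eq_right (by linarith)]
        nlinarith
      · rw [ramp_of_ge h', sub_self, mul_zero, add_zero]
        exact h1.trans (le_min zero_le_one (le_max_left _ _))

lemma abs_sub_ramp_expansion {N : ℕ} {u v : ℝ} (hu : 0 ≤ u) (hv : 0 ≤ v) (huN : u ≤ N)
    (hvN : v ≤ N) :
    |(|u - v| - (u + v - 2 * ∑ m ∈ Finset.range N, ramp m u * ramp m v))| ≤ 2 := by
  wlog h : u ≤ v
  · have := this hv hu hvN huN (le_of_not_ge h)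
    rwa [abs_sub_comm v, add_comm v, Finset.sum_congr rfl fun m _ => mul_comm (ramp m v) _] at this
  have hle : ∑ m ∈ Finset.range N, ramp m u * ramp m v ≤ u := by
    calc _ ≤ ∑ m ∈ Finset.range N, ramp m u :=
          Finset.sum_le_sum fun m _ => mul_le_of_le_one_right (ramp_nonneg _ _) (ramp_le_one _ _)
      _ = u := by rw [sum_ramp hu, min_eq_left huN]
  have hge : u - 1 ≤ ∑ m ∈ Finset.range N, ramp m u * ramp m v := by
    have h1 := (sum_ramp_mul_one_sub_le u N).trans (min_le_left _ _)
    have h2 : ∑ m ∈ Finset.range N, ramp m u * (1 - ramp m v) ≤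
        ∑ m ∈ Finset.range N, ramp m u * (1 - ramp m u) :=
      Finset.sum_le_sum fun m _ =>
        mul_le_mul_of_nonneg_left (by linarith [ramp_mono m h]) (ramp_nonneg _ _)
    have h3 : ∑ m ∈ Finset.range N, ramp m u * (1 - ramp m v) =
        u - ∑ m ∈ Finset.range N, ramp m u * ramp m v := by
      simp only [mul_sub, mul_one, Finset.sum_sub_distrib]
      rw [sum_ramp hu, min_eq_left huN]
    linarith
  rw [abs_of_nonpos (sub_nonpos.2 h), abs_le]
  constructor <;> linarith

end Ramp

section Kernel

variable {μ : Measure Ω} {Y : Ω → ℝ} {C : ℝ}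

lemma rho1_eq (hY : Measurable Y) (x : ℝ) : rho1 μ Y x = ∫ ω, |x - Y ω| ∂μ :=
  integral_map hY.aemeasurable (by fun_prop)

lemma h2_comm (x y : ℝ) : h2 μ Y x y = h2 μ Y y x := by
  rw [h2, h2, abs_sub_comm]; ring

variable [IsProbabilityMeasure μ]

lemma abs_integral_sub_integral_le {f g : Ω → ℝ} (hf : Integrable f μ) (hg : Integrable g μ)
    {e : ℝ} (h : ∀ ω, |f ω - g ω| ≤ e) : |∫ ω, f ω ∂μ - ∫ ω, g ω ∂μ| ≤ e := by
  rw [← integral_sub hf hg]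
  simpa using norm_integral_le_of_norm_le_const (μ := μ) (f := fun ω => f ω - g ω) (C := e) (Eventually.of_forall h)

lemma abs_integral_le_of_forall {f : Ω → ℝ} {e : ℝ} (h : ∀ ω, |f ω| ≤ e) :
    |∫ ω, f ω ∂μ| ≤ e := by
  simpa using norm_integral_le_of_norm_le_const (μ := μ) (f := f) (C := e) (Eventually.of_forall h)

lemma integrable_abs_sub (hY : Measurable Y) (hb : ∀ ω, |Y ω| ≤ C) (x : ℝ) :
    Integrable (fun ω => |x - Y ω|) μ :=
  integrable_of_forall_abs_le (by fun_prop) (B := |x| + C) fun ω => by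
    rw [abs_abs]; exact (abs_sub _ _).trans (by linarith [hb ω])

lemma abs_rho1_sub_le (hY : Measurable Y) (hb : ∀ ω, |Y ω| ≤ C) (x y : ℝ) :
    |rho1 μ Y x - rho1 μ Y y| ≤ |x - y| := by
  rw [rho1_eq hY, rho1_eq hY]
  refine abs_integral_sub_integral_le (integrable_abs_sub hY hb x) (integrable_abs_sub hY hb y)
    fun ω => ?_
  simpa using abs_abs_sub_abs_le (x - Y ω) (y - Y ω)

lemma measurable_rho1 (hY : Measurable Y) (hb : ∀ ω, |Y ω| ≤ C) : Measurable (rho1 μ Y) :=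
  (LipschitzWith.of_dist_le' (K := 1) fun x y => by
    rw [one_mul]; exact abs_rho1_sub_le hY hb x y).continuous.measurable

lemma giniTheta_eq (hY : Measurable Y) (hb : ∀ ω, |Y ω| ≤ C) :
    giniTheta μ Y = ∫ ω, rho1 μ Y (Y ω) ∂μ :=
  integral_map hY.aemeasurable (measurable_rho1 hY hb).aestronglyMeasurable

lemma abs_rho1_le (hY : Measurable Y) (hb : ∀ ω, |Y ω| ≤ C) {x : ℝ} (hx : |x| ≤ C) :
    |rho1 μ Y x| ≤ 2 * C := by
  rw [rho1_eq hY]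
  refine abs_integral_le_of_forall fun ω => ?_
  rw [abs_abs]; exact (abs_sub _ _).trans (by linarith [hb ω])

lemma abs_giniTheta_le (hY : Measurable Y) (hb : ∀ ω, |Y ω| ≤ C) : |giniTheta μ Y| ≤ 2 * C := by
  rw [giniTheta_eq hY hb]
  exact abs_integral_le_of_forall fun ω => abs_rho1_le hY hb (hb ω)

lemma abs_h2_le (hY : Measurable Y) (hb : ∀ ω, |Y ω| ≤ C) {x y : ℝ} (hx : |x| ≤ C)
    (hy : |y| ≤ C) : |h2 μ Y x y| ≤ 8 * C := by
  have h1 := abs_le.1 (abs_rho1_le (μ := μ) hY hb hx)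
  have h2' := abs_le.1 (abs_rho1_le (μ := μ) hY hb hy)
  have h3 := abs_le.1 (abs_giniTheta_le (μ := μ) hY hb)
  have h4 := abs_sub x y
  have h5 := abs_nonneg (x - y)
  rw [h2, abs_le]
  constructor <;> linarith

lemma abs_h2_sub_le (hY : Measurable Y) (hb : ∀ ω, |Y ω| ≤ C) (x y x' y' : ℝ) :
    |h2 μ Y x' y' - h2 μ Y x y| ≤ 2 * |x' - x| + 2 * |y' - y| := by
  have h1 := abs_le.1 (abs_rho1_sub_le (μ := μ) hY hb x' x)
  have h2' := abs_le.1 (abs_rho1_sub_le (μ := μ) hY hb y' y)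
  have h3 := abs_le.1 (abs_abs_sub_abs_le (x' - y') (x - y))
  have h4 : |(x' - y') - (x - y)| ≤ |x' - x| + |y' - y| := by
    rw [show (x' - y') - (x - y) = (x' - x) - (y' - y) by ring]; exact abs_sub _ _
  rw [h2, h2, abs_le]
  constructor <;> linarith

lemma measurable_h2 (hY : Measurable Y) (hb : ∀ ω, |Y ω| ≤ C) :
    Measurable fun p : ℝ × ℝ => h2 μ Y p.1 p.2 := by
  have := measurable_rho1 (μ := μ) hY hb
  unfold h2
  fun_prop

/-- The ramp rising from `0` to `1` on the `m`-th cell of the grid of mesh `δ` starting at `-C`. -/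
def gridRamp (C δ : ℝ) (m : ℕ) (x : ℝ) : ℝ := ramp m ((x + C) / δ)

lemma measurable_gridRamp (C δ : ℝ) (m : ℕ) : Measurable (gridRamp C δ m) :=
  (measurable_ramp m).comp (by fun_prop)

lemma abs_gridRamp_le (C δ : ℝ) (m : ℕ) (x : ℝ) : |gridRamp C δ m x| ≤ 1 :=
  abs_le.2 ⟨by linarith [ramp_nonneg m ((x + C) / δ), show gridRamp C δ m x = ramp m _ from rfl],
    ramp_le_one _ _⟩

lemma integrable_gridRamp (hY : Measurable Y) (δ : ℝ) (m : ℕ) :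
    Integrable (fun ω => gridRamp C δ m (Y ω)) μ :=
  integrable_of_forall_abs_le ((measurable_gridRamp C δ m).comp hY) fun _ => abs_gridRamp_le _ _ _ _

lemma abs_sub_gridRamp_expansion {δ : ℝ} {N : ℕ} (hδ : 0 < δ) (hN : N * δ = 2 * C) {x y : ℝ}
    (hx : |x| ≤ C) (hy : |y| ≤ C) :
    |(|x - y| - δ * ((x + C) / δ + (y + C) / δ -
      2 * ∑ m ∈ Finset.range N, gridRamp C δ m x * gridRamp C δ m y))| ≤ 2 * δ := by
  have hx' := abs_le.1 hx
  have hy' := abs_le.1 hy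
  have h := abs_sub_ramp_expansion (N := N) (u := (x + C) / δ) (v := (y + C) / δ)
    (div_nonneg (by linarith) hδ.le) (div_nonneg (by linarith) hδ.le)
    ((div_le_iff₀ hδ).2 (by linarith)) ((div_le_iff₀ hδ).2 (by linarith))
  have hd : |x - y| = δ * |(x + C) / δ - (y + C) / δ| := by
    rw [← sub_div, add_sub_add_right_eq_sub, abs_div, abs_of_pos hδ]; field_simp
  rw [hd, ← mul_sub, abs_mul, abs_of_pos hδ, mul_comm 2 δ]
  exact mul_le_mul_of_nonneg_left h hδ.le

/-- The degenerate Gini kernel is, up to `8 * δ`, a combination of products of centred ramps. -/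
lemma abs_h2_add_sum_le (hY : Measurable Y) (hb : ∀ ω, |Y ω| ≤ C) {δ : ℝ} {N : ℕ} (hδ : 0 < δ)
    (hN : N * δ = 2 * C) {x y : ℝ} (hx : |x| ≤ C) (hy : |y| ≤ C) :
    |h2 μ Y x y + 2 * δ * ∑ m ∈ Finset.range N,
      (gridRamp C δ m x - ∫ ω, gridRamp C δ m (Y ω) ∂μ) *
        (gridRamp C δ m y - ∫ ω, gridRamp C δ m (Y ω) ∂μ)| ≤ 8 * δ := by
  set p : ℕ → ℝ := fun m => ∫ ω, gridRamp C δ m (Y ω) ∂μ with hp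
  set E : ℝ := ∫ ω, (Y ω + C) / δ ∂μ with hE
  have hYi : Integrable (fun ω => (Y ω + C) / δ) μ :=
    ((integrable_of_forall_abs_le hY hb).add (integrable_const C)).div_const δ
  have hsumi : ∀ c : ℕ → ℝ,
      Integrable (fun ω => ∑ m ∈ Finset.range N, c m * gridRamp C δ m (Y ω)) μ := fun c =>
    integrable_finsetSum _ fun m _ => (integrable_gridRamp hY δ m).const_mul _
  have hAi : ∀ (a : ℝ) (c : ℕ → ℝ), Integrable (fun ω => δ * (a + (Y ω + C) / δ -
      2 * ∑ m ∈ Finset.range N, c m * gridRamp C δ m (Y ω))) μ := fun a c =>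
    (((integrable_const a).add hYi).sub ((hsumi c).const_mul 2)).const_mul δ
  have hAint : ∀ (a : ℝ) (c : ℕ → ℝ), ∫ ω, δ * (a + (Y ω + C) / δ -
      2 * ∑ m ∈ Finset.range N, c m * gridRamp C δ m (Y ω)) ∂μ =
        δ * (a + E - 2 * ∑ m ∈ Finset.range N, c m * p m) := fun a c => by
    have hai : Integrable (fun ω => a + (Y ω + C) / δ) μ := (integrable_const a).add hYi
    rw [integral_const_mul, integral_sub hai ((hsumi c).const_mul 2),
      integral_add (integrable_const a) hYi, integral_const_mul,
      integral_finsetSum _ fun m _ => (integrable_gridRamp hY δ m).const_mul _]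
    simp [integral_const_mul, hp, hE]
  have hρ : ∀ z, |z| ≤ C → |rho1 μ Y z - δ * ((z + C) / δ + E -
      2 * ∑ m ∈ Finset.range N, gridRamp C δ m z * p m)| ≤ 2 * δ := fun z hz => by
    rw [rho1_eq hY, ← hAint]
    exact abs_integral_sub_integral_le (integrable_abs_sub hY hb z) (hAi _ _)
      fun ω => abs_sub_gridRamp_expansion hδ hN hz (hb ω)
  have hθ : |giniTheta μ Y - δ * (E + E - 2 * ∑ m ∈ Finset.range N, p m * p m)| ≤ 2 * δ := by
    rw [giniTheta_eq hY hb, ← hAint]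
    refine abs_integral_sub_integral_le (integrable_of_forall_abs_le
      ((measurable_rho1 hY hb).comp hY) fun ω => abs_rho1_le hY hb (hb ω)) (hAi _ _) fun ω => ?_
    have := hρ (Y ω) (hb ω)
    rwa [add_comm _ E, Finset.sum_congr rfl fun m _ => mul_comm (gridRamp C δ m (Y ω)) _] at this
  have h0 := abs_le.1 (abs_sub_gridRamp_expansion hδ hN hx hy)
  have h1 := abs_le.1 (hρ x hx)
  have h2' := abs_le.1 (hρ y hy)
  have h3 := abs_le.1 hθ
  have halg : ∑ m ∈ Finset.range N, (gridRamp C δ m x - p m) * (gridRamp C δ m y - p m) =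
      ∑ m ∈ Finset.range N, gridRamp C δ m x * gridRamp C δ m y -
        ∑ m ∈ Finset.range N, gridRamp C δ m x * p m -
        ∑ m ∈ Finset.range N, gridRamp C δ m y * p m + ∑ m ∈ Finset.range N, p m * p m := by
    rw [← Finset.sum_sub_distrib, ← Finset.sum_sub_distrib, ← Finset.sum_add_distrib]
    exact Finset.sum_congr rfl fun m _ => by ring
  rw [halg, h2, abs_le]
  constructor <;> linarith

end Kernel

section Stationary

variable {μ : Measure Ω} {X : ℕ → Ω → ℝ}

lemma StrictStationary.integral_eq (hstat : StrictStationary μ X) (hmeas : ∀ j, Measurable (X j))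
    (k n : ℕ) {φ : (Fin n → ℝ) → ℝ} (hφ : Measurable φ) :
    ∫ ω, φ (fun i => X (1 + (i : ℕ) + k) ω) ∂μ = ∫ ω, φ (fun i => X (1 + (i : ℕ)) ω) ∂μ := by
  have h := congrArg (fun ν => ∫ x, φ x ∂ν) (hstat k n)
  rwa [integral_map (measurable_pi_lambda _ fun i => hmeas _).aemeasurable
      hφ.aestronglyMeasurable,
    integral_map (measurable_pi_lambda _ fun i => hmeas _).aemeasurable
      hφ.aestronglyMeasurable] at h

lemma StrictStationary.integral_comp_eq (hstat : StrictStationary μ X)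
    (hmeas : ∀ j, Measurable (X j)) {f : ℝ → ℝ} (hf : Measurable f) {i : ℕ} (hi : 1 ≤ i) :
    ∫ ω, f (X i ω) ∂μ = ∫ ω, f (X 1 ω) ∂μ := by
  have h := hstat.integral_eq hmeas (i - 1) 1 (φ := fun x => f (x 0))
    (hf.comp (measurable_pi_apply _))
  simpa [Nat.add_sub_cancel' hi] using h

lemma StrictStationary.cov_shift (hstat : StrictStationary μ X) (hmeas : ∀ j, Measurable (X j))
    {i : ℕ} (hi : 1 ≤ i) (d : ℕ) : cov μ (X i) (X (i + d)) = cov μ (X 1) (X (d + 1)) := by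
  have h := hstat.integral_eq hmeas (i - 1) (d + 1) (φ := fun x => x 0 * x (Fin.last d))
    (by fun_prop)
  have e : d + 1 + (i - 1) = i + d := by omega
  simp only [Fin.val_zero, Fin.val_last, add_zero, Nat.add_sub_cancel' hi, e, add_comm 1 d] at h
  have hmean : ∀ q, 1 ≤ q → ∫ ω, X q ω ∂μ = ∫ ω, X 1 ω ∂μ := fun q hq =>
    hstat.integral_comp_eq hmeas measurable_id hq
  rw [cov, cov, h, hmean i hi, hmean (i + d) (by omega), hmean (d + 1) (by omega)]

lemma cov_comm (f g : Ω → ℝ) : cov μ f g = cov μ g f := by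
  simp only [cov, mul_comm]

lemma StrictStationary.cov_eq (hstat : StrictStationary μ X) (hmeas : ∀ j, Measurable (X j))
    {p q : ℕ} (hp : 1 ≤ p) (hq : 1 ≤ q) :
    cov μ (X p) (X q) = cov μ (X 1) (X ((p - q) + (q - p) + 1)) := by
  rcases le_total p q with h | h
  · rw [← hstat.cov_shift hmeas hp]; congr 2; omega
  · rw [← hstat.cov_shift hmeas hq, cov_comm]; congr 2; omega

end Stationary

section Isolation

variable {μ : Measure Ω} [IsProbabilityMeasure μ] {X : ℕ → Ω → ℝ} {C : ℝ}

lemma abs_cov_le_of_bounded {f g : Ω → ℝ} (hf : ∀ ω, |f ω| ≤ C) (hg : ∀ ω, |g ω| ≤ C) :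
    |cov μ f g| ≤ 2 * C ^ 2 := by
  have h1 : |∫ ω, f ω * g ω ∂μ| ≤ C * C := abs_integral_le_of_forall fun ω => by
    rw [abs_mul]
    exact mul_le_mul (hf ω) (hg ω) (abs_nonneg _) ((abs_nonneg _).trans (hf ω))
  have h2 : |(∫ ω, f ω ∂μ) * ∫ ω, g ω ∂μ| ≤ C * C := by
    rw [abs_mul]
    have hf' := abs_integral_le_of_forall (μ := μ) hf
    exact mul_le_mul hf' (abs_integral_le_of_forall hg) (abs_nonneg _)
      ((abs_nonneg _).trans hf')
  rw [cov]
  exact (abs_sub _ _).trans (by linarith [sq C])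

/-- A product of a centred ramp in `X i` with the remaining factors is controlled by the
covariances of `X i` with the other variables. -/
lemma abs_integral_gridRamp_mul_le (hassoc : IsAssociated μ X) (hstat : StrictStationary μ X)
    (hmeas : ∀ j, Measurable (X j)) (hbdd : ∀ n, 1 ≤ n → ∀ ω, |X n ω| ≤ C)
    (hC : 0 < C) {δ : ℝ} (hδ : 0 < δ) (m : ℕ) {i j k l : ℕ} (hi : 1 ≤ i) (hj : 1 ≤ j)
    (hk : 1 ≤ k) (hl : 1 ≤ l) :
    |∫ ω, (gridRamp C δ m (X i ω) - ∫ ω, gridRamp C δ m (X 1 ω) ∂μ) *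
      ((gridRamp C δ m (X j ω) - ∫ ω, gridRamp C δ m (X 1 ω) ∂μ) *
        h2 μ (X 1) (X k ω) (X l ω)) ∂μ| ≤
      δ⁻¹ * (8 * C * δ⁻¹ * cov μ (X i) (X j) + 4 * cov μ (X i) (X k) +
        4 * cov μ (X i) (X l)) := by
  set p : ℝ := ∫ ω, gridRamp C δ m (X 1 ω) ∂μ with hp
  have hp1 : |p| ≤ 1 := abs_integral_le_of_forall fun ω => abs_gridRamp_le C δ m _
  have hη : ∀ x, |gridRamp C δ m x - p| ≤ 2 := fun x =>
    (abs_sub _ _).trans (by linarith [abs_gridRamp_le C δ m x])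
  have hφL : ∀ x x', |gridRamp C δ m x' - gridRamp C δ m x| ≤ δ⁻¹ * |x' - x| := fun x x' => by
    refine (abs_ramp_sub_le m _ _).trans_eq ?_
    rw [← sub_div, add_sub_add_right_eq_sub, abs_div, abs_of_pos hδ, div_eq_inv_mul]
  have hφm := measurable_gridRamp C δ m
  have hb1 := hbdd 1 le_rfl
  have hhm := measurable_h2 (μ := μ) (hmeas 1) hb1
  set Z : Ω → ℝ := fun ω => (gridRamp C δ m (X j ω) - p) * h2 μ (X 1) (X k ω) (X l ω) with hZ
  have hZm : Measurable Z :=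
    ((hφm.comp (hmeas j)).sub_const p).mul (hhm.comp ((hmeas k).prodMk (hmeas l)))
  have hZb : ∀ ω, |Z ω| ≤ 2 * (8 * C) := fun ω => by
    rw [hZ, abs_mul]
    exact mul_le_mul (hη _) (abs_h2_le (hmeas 1) hb1 (hbdd k hk ω) (hbdd l hl ω)) (abs_nonneg _)
      zero_le_two
  have hZi : Integrable Z μ := integrable_of_forall_abs_le hZm hZb
  have hφZ : Integrable (fun ω => gridRamp C δ m (X i ω) * Z ω) μ :=
    integrable_of_forall_abs_le ((hφm.comp (hmeas i)).mul hZm) (B := 1 * (2 * (8 * C)))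
      fun ω => by
        rw [abs_mul]
        exact mul_le_mul (abs_gridRamp_le _ _ _ _) (hZb ω) (abs_nonneg _) zero_le_one
  have hcov : ∫ ω, (gridRamp C δ m (X i ω) - p) * Z ω ∂μ =
      cov μ (fun ω => gridRamp C δ m (X i ω)) Z := by
    simp only [sub_mul]
    rw [integral_sub hφZ (hZi.const_mul p), integral_const_mul, cov,
      hstat.integral_comp_eq hmeas hφm hi]
  rw [hcov]
  refine hassoc.abs_cov_le hmeas hbdd hC.le hi hj hk hl (f := gridRamp C δ m)
    (G := fun x y z => (gridRamp C δ m x - p) * h2 μ (X 1) y z) (by positivity) (by norm_num)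
    (by norm_num) hφm ((hφm.comp measurable_fst |>.sub_const p).mul (hhm.comp measurable_snd))
    ?_ ?_ ?_
  · exact fun x y hxy => ramp_mono m (by gcongr)
  · intro x y hxy
    have h := monotone_sub_ramp m (show (x + C) / δ ≤ (y + C) / δ by gcongr)
    simp only [div_eq_inv_mul] at h
    simp only [gridRamp, div_eq_inv_mul]
    linarith
  · intro x y z x' y' z' hx hy hz hx' hy' hz'
    have e : (gridRamp C δ m x' - p) * h2 μ (X 1) y' z' - (gridRamp C δ m x - p) * h2 μ (X 1) y z =
        (gridRamp C δ m x' - gridRamp C δ m x) * h2 μ (X 1) y' z' +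
          (gridRamp C δ m x - p) * (h2 μ (X 1) y' z' - h2 μ (X 1) y z) := by ring
    have h1 : |(gridRamp C δ m x' - gridRamp C δ m x) * h2 μ (X 1) y' z'| ≤
        (δ⁻¹ * |x' - x|) * (8 * C) := by
      rw [abs_mul]
      exact mul_le_mul (hφL _ _) (abs_h2_le (hmeas 1) hb1 hy' hz') (abs_nonneg _) (by positivity)
    have h2' : |(gridRamp C δ m x - p) * (h2 μ (X 1) y' z' - h2 μ (X 1) y z)| ≤
        2 * (2 * |y' - y| + 2 * |z' - z|) := by
      rw [abs_mul]
      exact mul_le_mul (hη _) (abs_h2_sub_le (hmeas 1) hb1 _ _ _ _) (abs_nonneg _) zero_le_two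
    simp only [e]
    refine (abs_add_le _ _).trans ((add_le_add h1 h2').trans_eq ?_)
    ring

lemma abs_integral_h2_mul_h2_le_grid (hassoc : IsAssociated μ X) (hstat : StrictStationary μ X)
    (hmeas : ∀ j, Measurable (X j)) (hbdd : ∀ n, 1 ≤ n → ∀ ω, |X n ω| ≤ C)
    (hC : 0 < C) {N : ℕ} (hN : 1 ≤ N) {i j k l : ℕ} (hi : 1 ≤ i) (hj : 1 ≤ j)
    (hk : 1 ≤ k) (hl : 1 ≤ l) :
    |∫ ω, h2 μ (X 1) (X i ω) (X j ω) * h2 μ (X 1) (X k ω) (X l ω) ∂μ| ≤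
      128 * C ^ 2 / N + 8 * N ^ 2 *
        (cov μ (X i) (X j) + cov μ (X i) (X k) + cov μ (X i) (X l)) := by
  have hN0 : (0 : ℝ) < N := by exact_mod_cast hN
  have hN1 : (1 : ℝ) ≤ N := by exact_mod_cast hN
  set δ : ℝ := 2 * C / N with hδdef
  have hδ : 0 < δ := by positivity
  have hNδ : N * δ = 2 * C := by rw [hδdef]; field_simp
  have hb1 := hbdd 1 le_rfl
  have hhm := measurable_h2 (μ := μ) (hmeas 1) hb1
  set p : ℕ → ℝ := fun m => ∫ ω, gridRamp C δ m (X 1 ω) ∂μ with hp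
  set H : Ω → ℝ := fun ω => h2 μ (X 1) (X k ω) (X l ω) with hH
  have hHm : Measurable H := hhm.comp ((hmeas k).prodMk (hmeas l))
  have hHb : ∀ ω, |H ω| ≤ 8 * C := fun ω =>
    abs_h2_le (hmeas 1) hb1 (hbdd k hk ω) (hbdd l hl ω)
  set η : ℕ → ℕ → Ω → ℝ := fun q m ω => gridRamp C δ m (X q ω) - p m with hηdef
  have hηm : ∀ q m, Measurable (η q m) := fun q m =>
    ((measurable_gridRamp C δ m).comp (hmeas q)).sub_const _
  have hηb : ∀ q m ω, |η q m ω| ≤ 2 := fun q m ω => by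
    have h1 : |p m| ≤ 1 := abs_integral_le_of_forall fun ω => abs_gridRamp_le C δ m _
    exact (abs_sub _ _).trans (by linarith [abs_gridRamp_le C δ m (X q ω)])
  have hti : ∀ m, Integrable (fun ω => η i m ω * (η j m ω * H ω)) μ := fun m =>
    integrable_of_forall_abs_le ((hηm i m).mul ((hηm j m).mul hHm)) (B := 2 * (2 * (8 * C)))
      fun ω => by
        rw [abs_mul, abs_mul]
        exact mul_le_mul (hηb _ _ _) (mul_le_mul (hηb _ _ _) (hHb ω) (abs_nonneg _) zero_le_two)
          (by positivity) zero_le_two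
  have hsi : Integrable (fun ω => -(2 * δ) * ∑ m ∈ Finset.range N, η i m ω * (η j m ω * H ω)) μ :=
    (integrable_finsetSum _ fun m _ => hti m).const_mul _
  have hprod : Integrable (fun ω => h2 μ (X 1) (X i ω) (X j ω) * H ω) μ :=
    integrable_of_forall_abs_le ((hhm.comp ((hmeas i).prodMk (hmeas j))).mul hHm)
      (B := 8 * C * (8 * C)) fun ω => by
        rw [abs_mul]
        exact mul_le_mul (abs_h2_le (hmeas 1) hb1 (hbdd i hi ω) (hbdd j hj ω)) (hHb ω)
          (abs_nonneg _) (by positivity)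
  have happrox := abs_integral_sub_integral_le hprod hsi (e := 8 * δ * (8 * C)) fun ω => by
    have h := abs_h2_add_sum_le (μ := μ) (hmeas 1) hb1 hδ hNδ (hbdd i hi ω) (hbdd j hj ω)
    have e : h2 μ (X 1) (X i ω) (X j ω) * H ω -
        -(2 * δ) * ∑ m ∈ Finset.range N, η i m ω * (η j m ω * H ω) =
        (h2 μ (X 1) (X i ω) (X j ω) + 2 * δ * ∑ m ∈ Finset.range N, η i m ω * η j m ω) * H ω := by
      simp only [← mul_assoc, ← Finset.sum_mul]; ring
    rw [e, abs_mul]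
    exact mul_le_mul h (hHb ω) (abs_nonneg _) (by positivity)
  set a := cov μ (X i) (X j) with ha
  set b := cov μ (X i) (X k) with hb
  set c := cov μ (X i) (X l) with hc
  have hb0 : 0 ≤ b := hassoc.cov_nonneg hmeas hbdd hC.le hi hk
  have hc0 : 0 ≤ c := hassoc.cov_nonneg hmeas hbdd hC.le hi hl
  have hsum : |∫ ω, -(2 * δ) * ∑ m ∈ Finset.range N, η i m ω * (η j m ω * H ω) ∂μ| ≤
      2 * δ * (N * (δ⁻¹ * (8 * C * δ⁻¹ * a + 4 * b + 4 * c))) := by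
    rw [integral_const_mul, integral_finsetSum _ fun m _ => hti m, abs_mul, abs_neg,
      abs_of_pos (by positivity : 0 < 2 * δ)]
    refine mul_le_mul_of_nonneg_left ((Finset.abs_sum_le_sum_abs _ _).trans ?_) (by positivity)
    refine (Finset.sum_le_card_nsmul _ _ _ fun m _ =>
      abs_integral_gridRamp_mul_le hassoc hstat hmeas hbdd hC hδ m hi hj hk hl).trans_eq ?_
    rw [Finset.card_range, nsmul_eq_mul]
  have hlast : 2 * δ * (N * (δ⁻¹ * (8 * C * δ⁻¹ * a + 4 * b + 4 * c))) =
      8 * N ^ 2 * a + 8 * N * b + 8 * N * c := by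
    rw [hδdef]; field_simp; ring
  have hfirst : 8 * δ * (8 * C) = 128 * C ^ 2 / N := by rw [hδdef]; field_simp; ring
  have hNN : (N : ℝ) ≤ N ^ 2 := by nlinarith
  have h1 := mul_le_mul_of_nonneg_right hNN hb0
  have h2' := mul_le_mul_of_nonneg_right hNN hc0
  rw [hlast] at hsum
  rw [hfirst] at happrox
  have h3 := abs_sub_abs_le_abs_sub (∫ ω, h2 μ (X 1) (X i ω) (X j ω) * H ω ∂μ)
    (∫ ω, -(2 * δ) * ∑ m ∈ Finset.range N, η i m ω * (η j m ω * H ω) ∂μ)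
  linarith

end Isolation

section Counting

lemma le_cube_root_of_forall_nat {M A B R D : ℝ} (hA : 0 ≤ A) (hB : 0 ≤ B) (hR : 0 ≤ R)
    (hD : 0 < D) (hRD : R ≤ D) (h : ∀ N : ℕ, 1 ≤ N → M ≤ A / N + B * (N : ℝ) ^ 2 * R) :
    M ≤ (A + 4 * B * D) * (R / D) ^ (1 / 3 : ℝ) := by
  rcases hR.eq_or_lt with rfl | hR0
  · rw [zero_div, Real.zero_rpow (by norm_num), mul_zero]
    refine ge_of_tendsto (tendsto_const_div_atTop_nhds_zero_nat A) ?_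
    filter_upwards [eventually_ge_atTop 1] with N hN
    simpa using h N hN
  · set s : ℝ := (R / D) ^ (1 / 3 : ℝ) with hs
    have hs0 : 0 < s := Real.rpow_pos_of_pos (by positivity) _
    have hs1 : s ≤ 1 := Real.rpow_le_one (by positivity) ((div_le_one hD).2 hRD) (by norm_num)
    have hs3 : R = D * s ^ 3 := by
      rw [hs, ← Real.rpow_natCast, ← Real.rpow_mul (by positivity)]
      norm_num
      field_simp
    have hN1 : 1 ≤ ⌈1 / s⌉₊ := Nat.one_le_ceil_iff.2 (by positivity)
    have hlow : 1 / s ≤ (⌈1 / s⌉₊ : ℝ) := Nat.le_ceil _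
    have hup : (⌈1 / s⌉₊ : ℝ) ≤ 2 / s := by
      have h1 := (Nat.ceil_lt_add_one (show 0 ≤ 1 / s by positivity)).le
      have h2 : 1 ≤ 1 / s := (one_le_div hs0).2 hs1
      have h3 : 2 / s = 1 / s + 1 / s := by ring
      linarith
    calc M ≤ A / ⌈1 / s⌉₊ + B * (⌈1 / s⌉₊ : ℝ) ^ 2 * R := h _ hN1
      _ ≤ A / (1 / s) + B * (2 / s) ^ 2 * R := by gcongr
      _ = (A + 4 * B * D) * s := by rw [hs3]; field_simp; ring

lemma sqrt_cube_root_le {x y z D γ : ℝ} (hx : 0 ≤ x) (hy : 0 ≤ y) (hz : 0 ≤ z) (hD : 0 < D)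
    (hxyz : x + y + z ≤ D) (hγ0 : 0 < γ) (hγ : γ < 1 / 6) :
    √(((x + y + z) / D) ^ (1 / 3 : ℝ)) ≤ (D ^ γ)⁻¹ * (x ^ γ + y ^ γ + z ^ γ) := by
  have h0 : 0 ≤ (x + y + z) / D := by positivity
  have h1 : (x + y + z) / D ≤ 1 := (div_le_one hD).2 hxyz
  rw [Real.sqrt_eq_rpow, ← Real.rpow_mul h0]
  calc ((x + y + z) / D) ^ (1 / 3 * (1 / 2) : ℝ) ≤ ((x + y + z) / D) ^ γ :=
        Real.rpow_le_rpow_of_exponent_ge_of_imp h0 h1 (by linarith) fun _ h => absurd h (by norm_num)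
    _ = (D ^ γ)⁻¹ * (x + y + z) ^ γ := by
        rw [Real.div_rpow (by positivity) hD.le, div_eq_inv_mul]
    _ ≤ _ := by
        refine mul_le_mul_of_nonneg_left ?_ (by positivity)
        refine (Real.rpow_add_le_add_rpow (by positivity) hz hγ0.le (by linarith)).trans ?_
        gcongr
        exact Real.rpow_add_le_add_rpow hx hy hγ0.le (by linarith)

lemma sum_dist_le_two_mul_tsum {c : ℕ → ℝ} (hc : ∀ d, 0 ≤ c d) (hs : Summable c) (I : Finset ℕ)
    (p : ℕ) : ∑ q ∈ I, c ((p - q) + (q - p)) ≤ 2 * ∑' d, c d := by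
  have key : ∀ (J : Finset ℕ) (φ : ℕ → ℕ), Set.InjOn φ J → ∑ q ∈ J, c (φ q) ≤ ∑' d, c d :=
    fun J φ hφ => by
      rw [← Finset.sum_image hφ]
      exact hs.sum_le_tsum _ fun d _ => hc d
  rw [← Finset.sum_filter_add_sum_filter_not I (· ≤ p), two_mul]
  refine add_le_add (key _ _ ?_) (key _ _ ?_) <;>
  · intro a ha b hb hab
    simp only [Finset.coe_filter, Set.mem_ofPred_eq] at ha hb
    simp only at hab
    omega

/-- If every argument of `M` can be isolated at the cost of its weights to the other arguments,
then the sum of `M` over quadruples is quadratic in the number of indices. -/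
lemma sum_quadruple_le {I : Finset ℕ} {M : ℕ → ℕ → ℕ → ℕ → ℝ} {w : ℕ → ℕ → ℝ} {K T : ℝ}
    (hK : 0 ≤ K) (hM : ∀ i j k l, 0 ≤ M i j k l) (hM₁ : ∀ i j k l, M j i k l = M i j k l)
    (hM₂ : ∀ i j k l, M k l i j = M i j k l) (hw : ∀ p ∈ I, ∀ q ∈ I, 0 ≤ w p q)
    (hwc : ∀ p q, w q p = w p q) (hT : ∀ p ∈ I, ∑ q ∈ I, w p q ≤ T)
    (h : ∀ i ∈ I, ∀ j ∈ I, ∀ k ∈ I, ∀ l ∈ I, √(M i j k l) ≤ K * (w i j + w i k + w i l)) :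
    ∑ i ∈ I, ∑ j ∈ I, ∑ k ∈ I, ∑ l ∈ I, M i j k l ≤ 9 * K ^ 2 * T ^ 2 * (I.card : ℝ) ^ 2 := by
  rcases I.eq_empty_or_nonempty with rfl | ⟨p₀, hp₀⟩
  · simp
  have hT0 : 0 ≤ T := (Finset.sum_nonneg fun q hq => hw p₀ hp₀ q hq).trans (hT p₀ hp₀)
  set n : ℝ := (I.card : ℝ) with hn
  set V : ℕ → ℕ → ℝ := fun i k => ∑ l ∈ I, w i l * w l k with hV
  have hpoint : ∀ i ∈ I, ∀ j ∈ I, ∀ k ∈ I, ∀ l ∈ I, M i j k l ≤ K ^ 2 *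
      (w i j * w i k + w i j * w j k + w i j * w k l + w i k * w i l + w i k * w j l +
        w i k * w k l + w i k * w i l + w j k * w i l + w i l * w l k) := by
    intro i hi j hj k hk l hl
    have h1 := h i hi j hj k hk l hl
    have h2 := h k hk l hl i hi j hj
    have h3 := h l hl k hk i hi j hj
    rw [hM₂] at h2
    rw [hM₁, hM₂] at h3
    have hs0 := Real.sqrt_nonneg (M i j k l)
    have hsq := Real.mul_self_sqrt (hM i j k l)
    have m1 := mul_le_mul_of_nonneg_left h1 hs0
    have m2 := mul_le_mul_of_nonneg_left h2 (mul_nonneg hK (hw i hi j hj))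
    have m3 := mul_le_mul_of_nonneg_left h3 (mul_nonneg hK (hw i hi k hk))
    have m4 := mul_le_mul_of_nonneg_left h2 (mul_nonneg hK (hw i hi l hl))
    rw [hwc i k, hwc j k] at m2 m4
    rw [hwc i l, hwc j l, hwc k l] at m3
    rw [hwc k l]
    nlinarith
  have hl : ∀ i ∈ I, ∀ j ∈ I, ∀ k ∈ I, ∑ l ∈ I, M i j k l ≤ K ^ 2 *
      (n * w i j * w i k + n * w i j * w j k + T * w i j + 4 * T * w i k + T * w j k +
        V i k) := by
    intro i hi j hj k hk
    refine (Finset.sum_le_sum fun l hl => hpoint i hi j hj k hk l hl).trans ?_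
    rw [← Finset.mul_sum]
    refine mul_le_mul_of_nonneg_left ?_ (sq_nonneg K)
    simp only [Finset.sum_add_distrib, ← Finset.mul_sum, Finset.sum_const, nsmul_eq_mul, ← hn]
    have hij := hw i hi j hj
    have hik := hw i hi k hk
    have hjk := hw j hj k hk
    have m1 := mul_le_mul_of_nonneg_left (hT k hk) hij
    have m2 := mul_le_mul_of_nonneg_left (hT i hi) hik
    have m3 := mul_le_mul_of_nonneg_left (hT j hj) hik
    have m4 := mul_le_mul_of_nonneg_left (hT k hk) hik
    have m5 := mul_le_mul_of_nonneg_left (hT i hi) hjk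
    simp only [hV]
    linarith
  have hVsum : ∀ i ∈ I, ∑ k ∈ I, V i k ≤ T * T := by
    intro i hi
    simp only [hV]
    rw [Finset.sum_comm]
    simp only [← Finset.mul_sum]
    calc ∑ l ∈ I, w i l * ∑ k ∈ I, w l k ≤ ∑ l ∈ I, w i l * T :=
          Finset.sum_le_sum fun l hl => mul_le_mul_of_nonneg_left (hT l hl) (hw i hi l hl)
      _ ≤ T * T := by
          rw [← Finset.sum_mul]; exact mul_le_mul_of_nonneg_right (hT i hi) hT0
  have hk : ∀ i ∈ I, ∀ j ∈ I, ∑ k ∈ I, ∑ l ∈ I, M i j k l ≤ K ^ 2 *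
      (3 * n * T * w i j + 6 * T ^ 2) := by
    intro i hi j hj
    refine (Finset.sum_le_sum fun k hk => hl i hi j hj k hk).trans ?_
    rw [← Finset.mul_sum]
    refine mul_le_mul_of_nonneg_left ?_ (sq_nonneg K)
    simp only [Finset.sum_add_distrib, ← Finset.mul_sum, Finset.sum_const, nsmul_eq_mul, ← hn]
    have hnij : 0 ≤ n * w i j := mul_nonneg (by positivity) (hw i hi j hj)
    have m1 := mul_le_mul_of_nonneg_left (hT i hi) hnij
    have m2 := mul_le_mul_of_nonneg_left (hT j hj) hnij
    have m3 := mul_le_mul_of_nonneg_left (hT i hi) hT0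
    have m4 := mul_le_mul_of_nonneg_left (hT j hj) hT0
    have m5 := hVsum i hi
    linarith
  have hj : ∀ i ∈ I, ∑ j ∈ I, ∑ k ∈ I, ∑ l ∈ I, M i j k l ≤ K ^ 2 * (9 * n * T ^ 2) := by
    intro i hi
    refine (Finset.sum_le_sum fun j hj => hk i hi j hj).trans ?_
    rw [← Finset.mul_sum]
    refine mul_le_mul_of_nonneg_left ?_ (sq_nonneg K)
    simp only [Finset.sum_add_distrib, ← Finset.mul_sum, Finset.sum_const, nsmul_eq_mul, ← hn]
    have m1 := mul_le_mul_of_nonneg_left (hT i hi) (show 0 ≤ 3 * n * T by positivity)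
    linarith
  refine (Finset.sum_le_card_nsmul _ _ _ hj).trans_eq ?_
  rw [nsmul_eq_mul, ← hn]
  ring

end Counting

lemma exists_sqrt_abs_integral_h2_mul_h2_le {μ : Measure Ω} [IsProbabilityMeasure μ]
    {X : ℕ → Ω → ℝ} {C γ : ℝ} (hassoc : IsAssociated μ X) (hstat : StrictStationary μ X)
    (hmeas : ∀ j, Measurable (X j)) (hbdd : ∀ n, 1 ≤ n → ∀ ω, |X n ω| ≤ C) (hC : 0 < C)
    (hγ0 : 0 < γ) (hγ : γ < 1 / 6) :
    ∃ K : ℝ, 0 ≤ K ∧ ∀ i j k l : ℕ, 1 ≤ i → 1 ≤ j → 1 ≤ k → 1 ≤ l →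
      √|∫ ω, h2 μ (X 1) (X i ω) (X j ω) * h2 μ (X 1) (X k ω) (X l ω) ∂μ| ≤
        K * (cov μ (X i) (X j) ^ γ + cov μ (X i) (X k) ^ γ + cov μ (X i) (X l) ^ γ) := by
  set D : ℝ := 6 * C ^ 2 with hD
  set B : ℝ := 128 * C ^ 2 + 4 * 8 * D with hB
  refine ⟨√B * (D ^ γ)⁻¹, by positivity, fun i j k l hi hj hk hl => ?_⟩
  have hnn : ∀ q, 1 ≤ q → 0 ≤ cov μ (X i) (X q) := fun q hq =>
    hassoc.cov_nonneg hmeas hbdd hC.le hi hq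
  have hle : ∀ q, 1 ≤ q → cov μ (X i) (X q) ≤ 2 * C ^ 2 := fun q hq =>
    (le_abs_self _).trans (abs_cov_le_of_bounded (hbdd i hi) (hbdd q hq))
  have hsumle : cov μ (X i) (X j) + cov μ (X i) (X k) + cov μ (X i) (X l) ≤ D := by
    linarith [hle j hj, hle k hk, hle l hl]
  have h := le_cube_root_of_forall_nat (by positivity) (by norm_num)
    (add_nonneg (add_nonneg (hnn j hj) (hnn k hk)) (hnn l hl)) (by positivity) hsumle
    fun N hN => abs_integral_h2_mul_h2_le_grid hassoc hstat hmeas hbdd hC hN hi hj hk hl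
  refine (Real.sqrt_le_sqrt h).trans ?_
  rw [Real.sqrt_mul (by positivity), ← hB, mul_assoc (√B)]
  exact mul_le_mul_of_nonneg_left (sqrt_cube_root_le (hnn j hj) (hnn k hk) (hnn l hl)
    (by positivity) hsumle hγ0 hγ) (Real.sqrt_nonneg _)

/-- **Lemma 3.1**: for a bounded stationary associated sequence whose marginal has a
bounded density, if `∑_{j=1}^∞ Cov(X₁, Xⱼ)^γ < ∞` for some `0 < γ < 1/6`, then
`∑_{1 ≤ i < j ≤ n} ∑_{1 ≤ k < l ≤ n} |E(h⁽²⁾(X_i,X_j) h⁽²⁾(X_k,X_l))| = o(n³)`. -/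
theorem h2_sum_little_o (μ : Measure Ω) [IsProbabilityMeasure μ]
    (X : ℕ → Ω → ℝ) (hmeas : ∀ j, Measurable (X j))
    (hstat : StrictStationary μ X) (hassoc : IsAssociated μ X)
    (C₁ : ℝ) (hbdd : ∀ n : ℕ, 1 ≤ n → ∀ ω, |X n ω| ≤ C₁)
    (hdens : HasBddDensity μ (X 1))
    (γ : ℝ) (hγ0 : 0 < γ) (hγ : γ < 1 / 6)
    (hsum : Summable fun j : ℕ => cov μ (X 1) (X (j + 1)) ^ γ) :
    Tendsto (fun n : ℕ =>
        (∑ i ∈ Finset.Icc 1 n, ∑ j ∈ Finset.Icc (i + 1) n,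
          ∑ k ∈ Finset.Icc 1 n, ∑ l ∈ Finset.Icc (k + 1) n,
            |∫ ω, h2 μ (X 1) (X i ω) (X j ω) * h2 μ (X 1) (X k ω) (X l ω) ∂μ|) / (n : ℝ) ^ 3)
      atTop (𝓝 0) := by
  have hC : 0 < |C₁| + 1 := by positivity
  have hb : ∀ n : ℕ, 1 ≤ n → ∀ ω, |X n ω| ≤ |C₁| + 1 := fun n hn ω =>
    (hbdd n hn ω).trans (by linarith [le_abs_self C₁])
  obtain ⟨K, hK, hbound⟩ := exists_sqrt_abs_integral_h2_mul_h2_le hassoc hstat hmeas hb hC hγ0 hγ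
  set M : ℕ → ℕ → ℕ → ℕ → ℝ := fun i j k l =>
    |∫ ω, h2 μ (X 1) (X i ω) (X j ω) * h2 μ (X 1) (X k ω) (X l ω) ∂μ| with hM
  set T : ℝ := 2 * ∑' d : ℕ, cov μ (X 1) (X (d + 1)) ^ γ with hT
  have hM0 : ∀ i j k l, 0 ≤ M i j k l := fun i j k l => abs_nonneg _
  have htotal : ∀ n : ℕ, ∑ i ∈ Finset.Icc 1 n, ∑ j ∈ Finset.Icc 1 n, ∑ k ∈ Finset.Icc 1 n,
      ∑ l ∈ Finset.Icc 1 n, M i j k l ≤ 9 * K ^ 2 * T ^ 2 * (n : ℝ) ^ 2 := fun n => by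
    have hone : ∀ {q}, q ∈ Finset.Icc 1 n → 1 ≤ q := fun hq => (Finset.mem_Icc.1 hq).1
    have h := sum_quadruple_le (I := Finset.Icc 1 n) (M := M)
      (w := fun p q => cov μ (X p) (X q) ^ γ) (T := T) hK hM0
      (fun i j k l => by simp only [hM, h2_comm (X j _)])
      (fun i j k l => by simp only [hM, mul_comm (h2 μ (X 1) (X k _) _)])
      (fun p hp q hq => Real.rpow_nonneg (hassoc.cov_nonneg hmeas hb hC.le (hone hp) (hone hq)) _)
      (fun p q => by simp only [cov_comm (X q)])
      (fun p hp => by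
        refine le_of_eq_of_le (Finset.sum_congr rfl fun q hq => ?_)
          (sum_dist_le_two_mul_tsum (fun d => Real.rpow_nonneg
            (hassoc.cov_nonneg hmeas hb hC.le le_rfl d.succ_pos) γ) hsum (Finset.Icc 1 n) p)
        rw [hstat.cov_eq hmeas (hone hp) (hone hq)])
      (fun i hi j hj k hk l hl => hbound i j k l (hone hi) (hone hj) (hone hk) (hone hl))
    simpa using h
  have hsub : ∀ n i : ℕ, Finset.Icc (i + 1) n ⊆ Finset.Icc 1 n := fun n i =>
    Finset.Icc_subset_Icc_left (by omega)
  have hle : ∀ n : ℕ, ∑ i ∈ Finset.Icc 1 n, ∑ j ∈ Finset.Icc (i + 1) n, ∑ k ∈ Finset.Icc 1 n,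
      ∑ l ∈ Finset.Icc (k + 1) n, M i j k l ≤ 9 * K ^ 2 * T ^ 2 * (n : ℝ) ^ 2 := fun n => by
    refine le_trans (Finset.sum_le_sum fun i _ => ?_) (htotal n)
    refine (Finset.sum_le_sum_of_subset_of_nonneg (hsub n i) fun j _ _ =>
      Finset.sum_nonneg fun k _ => Finset.sum_nonneg fun l _ => hM0 i j k l).trans ?_
    exact Finset.sum_le_sum fun j _ => Finset.sum_le_sum fun k _ =>
      Finset.sum_le_sum_of_subset_of_nonneg (hsub n k) fun l _ _ => hM0 i j k l
  refine squeeze_zero' (Eventually.of_forall fun n => div_nonneg (Finset.sum_nonneg fun i _ =>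
    Finset.sum_nonneg fun j _ => Finset.sum_nonneg fun k _ => Finset.sum_nonneg fun l _ =>
      hM0 i j k l) (by positivity)) ?_
    (tendsto_const_div_atTop_nhds_zero_nat (9 * K ^ 2 * T ^ 2))
  filter_upwards [eventually_ge_atTop 1] with n hn
  have hn0 : (0 : ℝ) < n := by exact_mod_cast hn
  rw [div_le_div_iff₀ (by positivity) hn0]
  calc _ ≤ 9 * K ^ 2 * T ^ 2 * (n : ℝ) ^ 2 * n := mul_le_mul_of_nonneg_right (hle n) hn0.le
    _ = _ := by ring
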